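/- Let Ω̄ be a d×d symmetric positive-definite matrix with unit diagonal, let α ∈ ℝ^d, and let I be a nonempty proper subset of {1,…,d} with complement Ī. Define the Schur complement Ω̃_{ĪĪ·I} = Ω̄_{ĪĪ} − Ω̄_{ĪI} Ω̄_{II}⁻¹ Ω̄_{IĪ} and α*_I = (α_I + Ω̄_{II}⁻¹ Ω̄_{IĪ} α_Ī) / √(1 + α_Īᵀ Ω̃_{ĪĪ·I} α_Ī). Then (1 + α*_Iᵀ Ω̄_{II} α*_I)(1 + α_Īᵀ Ω̃_{ĪĪ·I} α_Ī) = 1 + αᵀ Ω̄ α. In particular, for any τ ∈ ℝ, τ*_I/√(1 + α*_Iᵀ Ω̄_{II} α*_I) = τ/√(1 + αᵀΩ̄α), where τ*_I = τ/√(1 + α_Īᵀ Ω̃_{ĪĪ·I} α_Ī). -/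

import Mathlib

open MeasureTheory Real Filter Matrix Set Topology Asymptotics

noncomputable section

/-- Standard normal density. -/
def nPdf (x : ℝ) : ℝ := (Real.sqrt (2 * π))⁻¹ * Real.exp (-(x ^ 2) / 2)

/-- Standard normal distribution function. -/
def nCdf (x : ℝ) : ℝ := ∫ u in Set.Iio x, nPdf u

/-- Centred multivariate normal density with covariance matrix `S`. -/
def mvnPdf {ι : Type*} [Fintype ι] [DecidableEq ι] (S : Matrix ι ι ℝ) (y : ι → ℝ) : ℝ :=
  (2 * π) ^ (-(Fintype.card ι : ℝ) / 2) * S.det ^ (-(1 : ℝ) / 2) *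
    Real.exp (-(y ⬝ᵥ S⁻¹.mulVec y) / 2)

/-- Centred multivariate normal distribution function. -/
def mvnCdf {ι : Type*} [Fintype ι] [DecidableEq ι] (S : Matrix ι ι ℝ) (w : ι → ℝ) : ℝ :=
  ∫ u in Set.univ.pi fun i => Set.Iic (w i), mvnPdf S u

/-- Multivariate central Student-t density with scale matrix `S` and `ν` degrees of freedom. -/
def tPdf {ι : Type*} [Fintype ι] [DecidableEq ι] (S : Matrix ι ι ℝ) (ν : ℝ) (y : ι → ℝ) : ℝ :=
  Real.Gamma ((ν + Fintype.card ι) / 2) *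
      (1 + y ⬝ᵥ S⁻¹.mulVec y / ν) ^ (-(ν + Fintype.card ι) / 2) /
    (Real.Gamma (ν / 2) * (ν * π) ^ ((Fintype.card ι : ℝ) / 2) * Real.sqrt S.det)

/-- Univariate non-central t distribution function with non-centrality `a`. -/
def nctCdf (x a ν : ℝ) : ℝ :=
  ∫ v in Set.Ioi (0 : ℝ),
    v ^ (ν / 2 - 1) * Real.exp (-v) / Real.Gamma (ν / 2) *
      nCdf (x * Real.sqrt (2 * v / ν) - a)

/-- Multivariate non-central t distribution function. -/
def mvnctCdf {ι : Type*} [Fintype ι] [DecidableEq ι]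
    (y : ι → ℝ) (S : Matrix ι ι ℝ) (κ : ι → ℝ) (ν : ℝ) : ℝ :=
  ∫ v in Set.Ioi (0 : ℝ),
    v ^ (ν / 2 - 1) * Real.exp (-v) / Real.Gamma (ν / 2) *
      mvnCdf S fun i => y i * Real.sqrt (2 * v / ν) - κ i

/-- Multivariate non-central t density (scale-mixture form). -/
def mvnctPdf {ι : Type*} [Fintype ι] [DecidableEq ι]
    (μ : ι → ℝ) (S : Matrix ι ι ℝ) (κ : ι → ℝ) (ν : ℝ) (y : ι → ℝ) : ℝ :=
  ∫ v in Set.Ioi (0 : ℝ),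
    v ^ (ν / 2 - 1) * Real.exp (-v) / Real.Gamma (ν / 2) *
      ((2 * v / ν) ^ ((Fintype.card ι : ℝ) / 2) *
        mvnPdf S fun i => Real.sqrt (2 * v / ν) * (y i - μ i) - κ i)

/-- Univariate non-central t density with location `μ`, scale (standard deviation) `s`,
non-centrality `κ` and `ν` degrees of freedom. -/
def nctPdf1 (μ s κ ν x : ℝ) : ℝ :=
  ∫ v in Set.Ioi (0 : ℝ),
    v ^ (ν / 2 - 1) * Real.exp (-v) / Real.Gamma (ν / 2) *
      (Real.sqrt (2 * v / ν) * s⁻¹ * nPdf (Real.sqrt (2 * v / ν) * (x - μ) / s - κ))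

/-- Non-central extended skew-t density. -/
def skewTPdf {ι : Type*} [Fintype ι] [DecidableEq ι]
    (μ : ι → ℝ) (Ω : Matrix ι ι ℝ) (α : ι → ℝ) (τ κ ν : ℝ) (y : ι → ℝ) : ℝ :=
  let d : ℝ := Fintype.card ι
  let ω : Matrix ι ι ℝ := Matrix.diagonal fun i => Real.sqrt (Ω i i)
  let Ωb : Matrix ι ι ℝ := ω⁻¹ * Ω * ω⁻¹
  let z : ι → ℝ := ω⁻¹.mulVec fun i => y i - μ i
  let Q : ℝ := α ⬝ᵥ Ωb.mulVec α
  tPdf Ω ν (fun i => y i - μ i) *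
      nctCdf ((α ⬝ᵥ z + τ) * Real.sqrt ((ν + d) / (ν + z ⬝ᵥ Ωb⁻¹.mulVec z))) κ (ν + d) /
    nctCdf (τ / Real.sqrt (1 + Q)) (κ / Real.sqrt (1 + Q)) ν

/-- Non-central extended skew-t distribution function. -/
def skewTCdf {ι : Type*} [Fintype ι] [DecidableEq ι]
    (μ : ι → ℝ) (Ω : Matrix ι ι ℝ) (α : ι → ℝ) (τ κ ν : ℝ) (y : ι → ℝ) : ℝ :=
  ∫ u in Set.univ.pi fun i => Set.Iic (y i), skewTPdf μ Ω α τ κ ν u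


theorem aux_schur {m n : Type*} [Fintype m] [DecidableEq m] [Fintype n]
    (A : Matrix m m ℝ) (B : Matrix m n ℝ) (C : Matrix n m ℝ) (D : Matrix n n ℝ)
    (hA : IsUnit A.det) (hAt : Aᵀ = A) (hC : C = Bᵀ) (a : m → ℝ) (c : n → ℝ) :
    a ⬝ᵥ A *ᵥ a + a ⬝ᵥ B *ᵥ c + (c ⬝ᵥ C *ᵥ a + c ⬝ᵥ D *ᵥ c) =
      (a + A⁻¹ *ᵥ (B *ᵥ c)) ⬝ᵥ A *ᵥ (a + A⁻¹ *ᵥ (B *ᵥ c)) +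
        c ⬝ᵥ (D - C * A⁻¹ * B) *ᵥ c := by
  have h1 : A *ᵥ (A⁻¹ *ᵥ (B *ᵥ c)) = B *ᵥ c := by
    rw [Matrix.mulVec_mulVec, Matrix.mul_nonsing_inv _ hA, Matrix.one_mulVec]
  have hc : ∀ x : m → ℝ, c ⬝ᵥ C *ᵥ x = x ⬝ᵥ B *ᵥ c := by
    intro x
    rw [hC, Matrix.dotProduct_mulVec, Matrix.vecMul_transpose, dotProduct_comm]
  have h2 : (A⁻¹ *ᵥ (B *ᵥ c)) ⬝ᵥ A *ᵥ a = a ⬝ᵥ B *ᵥ c := by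
    rw [Matrix.dotProduct_mulVec, ← Matrix.mulVec_transpose, hAt, h1, dotProduct_comm]
  rw [Matrix.mulVec_add, h1, Matrix.sub_mulVec, dotProduct_sub, ← Matrix.mulVec_mulVec,
    ← Matrix.mulVec_mulVec, hc, hc, dotProduct_add, add_dotProduct, add_dotProduct, h2]
  ring

theorem aux_split {d : ℕ} (S : Finset (Fin d)) (f : Fin d → ℝ) :
    ∑ i, f i = ∑ i : {i // i ∈ S}, f i.1 + ∑ i : {i // i ∉ S}, f i.1 := by
  rw [← Fintype.sum_subtype_add_sum_subtype (fun i => i ∈ S) f]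
  congr 1
  exact Finset.sum_congr (by ext; simp) fun _ _ => rfl

theorem aux_quad {d : ℕ} (S : Finset (Fin d)) (W : Matrix (Fin d) (Fin d) ℝ) (x : Fin d → ℝ) :
    x ⬝ᵥ W *ᵥ x =
      (fun i : {i // i ∈ S} => x i.1) ⬝ᵥ
          (fun i j => W i.1 j.1 : Matrix {i // i ∈ S} {i // i ∈ S} ℝ) *ᵥ (fun i => x i.1) +
        (fun i : {i // i ∈ S} => x i.1) ⬝ᵥ
          (fun i j => W i.1 j.1 : Matrix {i // i ∈ S} {i // i ∉ S} ℝ) *ᵥ (fun i => x i.1) +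
      ((fun i : {i // i ∉ S} => x i.1) ⬝ᵥ
          (fun i j => W i.1 j.1 : Matrix {i // i ∉ S} {i // i ∈ S} ℝ) *ᵥ (fun i => x i.1) +
        (fun i : {i // i ∉ S} => x i.1) ⬝ᵥ
          (fun i j => W i.1 j.1 : Matrix {i // i ∉ S} {i // i ∉ S} ℝ) *ᵥ (fun i => x i.1)) := by
  simp only [dotProduct, Matrix.mulVec]
  rw [aux_split S]
  simp only [← Finset.sum_add_distrib, ← mul_add]
  congr 1 <;> refine Finset.sum_congr rfl fun i _ => ?_ <;> rw [aux_split S]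

/-- skewness-parameter identity for marginals of skew-symmetric families. -/
theorem skewness_marginal_identity
    (d : ℕ) (Ωb : Matrix (Fin d) (Fin d) ℝ) (hpd : Ωb.PosDef)
    (hdiag : ∀ i, Ωb i i = 1) (α : Fin d → ℝ) (τ : ℝ)
    (S : Finset (Fin d)) (hS : S.Nonempty) (hS' : S ≠ Finset.univ) :
    let ΩII : Matrix {i // i ∈ S} {i // i ∈ S} ℝ := fun i j => Ωb i.1 j.1
    let ΩIC : Matrix {i // i ∈ S} {i // i ∉ S} ℝ := fun i j => Ωb i.1 j.1
    let ΩCI : Matrix {i // i ∉ S} {i // i ∈ S} ℝ := fun i j => Ωb i.1 j.1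
    let ΩCC : Matrix {i // i ∉ S} {i // i ∉ S} ℝ := fun i j => Ωb i.1 j.1
    let Ωt : Matrix {i // i ∉ S} {i // i ∉ S} ℝ := ΩCC - ΩCI * ΩII⁻¹ * ΩIC
    let αI : {i // i ∈ S} → ℝ := fun i => α i.1
    let αC : {i // i ∉ S} → ℝ := fun i => α i.1
    let αstar : {i // i ∈ S} → ℝ := fun i =>
      (αI i + ΩII⁻¹.mulVec (ΩIC.mulVec αC) i) / Real.sqrt (1 + αC ⬝ᵥ Ωt.mulVec αC)
    (1 + αstar ⬝ᵥ ΩII.mulVec αstar) * (1 + αC ⬝ᵥ Ωt.mulVec αC) = 1 + α ⬝ᵥ Ωb.mulVec α ∧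
    (τ / Real.sqrt (1 + αC ⬝ᵥ Ωt.mulVec αC)) / Real.sqrt (1 + αstar ⬝ᵥ ΩII.mulVec αstar) =
      τ / Real.sqrt (1 + α ⬝ᵥ Ωb.mulVec α) := by
  intro ΩII ΩIC ΩCI ΩCC Ωt αI αC αstar
  have hsym : ∀ i j, Ωb i j = Ωb j i := fun i j => by
    simpa using (hpd.1.apply i j).symm
  have hII : ΩII.PosDef := hpd.submatrix (e := (Subtype.val : {i // i ∈ S} → Fin d))
    Subtype.val_injective
  have hu : IsUnit ΩII.det := (Matrix.isUnit_iff_isUnit_det _).1 hII.isUnit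
  have hAt : ΩIIᵀ = ΩII := by
    ext i j
    exact hsym _ _
  have hC : ΩCI = ΩICᵀ := by
    ext i j
    exact hsym _ _
  have key := aux_schur ΩII ΩIC ΩCI ΩCC hu hAt hC
  have hnn : 0 ≤ αC ⬝ᵥ Ωt *ᵥ αC := by
    let x : Fin d → ℝ := fun i => if h : i ∈ S then (-(ΩII⁻¹ *ᵥ (ΩIC *ᵥ αC))) ⟨i, h⟩ else α i
    have hx1 : (fun i : {i // i ∈ S} => x i.1) = -(ΩII⁻¹ *ᵥ (ΩIC *ᵥ αC)) := by
      funext i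
      simp only [x, dif_pos i.2]
    have hx2 : (fun i : {i // i ∉ S} => x i.1) = αC := by
      funext i
      simp only [x, dif_neg i.2, αC]
    have h := hpd.posSemidef.dotProduct_mulVec_nonneg x
    rw [star_trivial, aux_quad S, hx1, hx2] at h
    have k := key (-(ΩII⁻¹ *ᵥ (ΩIC *ᵥ αC))) αC
    rw [neg_add_cancel, zero_dotProduct, zero_add] at k
    exact h.trans_eq k
  have hq : α ⬝ᵥ Ωb *ᵥ α = (αI + ΩII⁻¹ *ᵥ (ΩIC *ᵥ αC)) ⬝ᵥ ΩII *ᵥ (αI + ΩII⁻¹ *ᵥ (ΩIC *ᵥ αC)) +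
      αC ⬝ᵥ Ωt *ᵥ αC := (aux_quad S Ωb α).trans (key αI αC)
  have hs : αstar = (Real.sqrt (1 + αC ⬝ᵥ Ωt *ᵥ αC))⁻¹ • (αI + ΩII⁻¹ *ᵥ (ΩIC *ᵥ αC)) := by
    funext i
    simp only [αstar, Pi.smul_apply, Pi.add_apply, smul_eq_mul]
    rw [div_eq_inv_mul]
  have hmain : (1 + αstar ⬝ᵥ ΩII *ᵥ αstar) * (1 + αC ⬝ᵥ Ωt *ᵥ αC) = 1 + α ⬝ᵥ Ωb *ᵥ α := by
    rw [hq, hs, Matrix.mulVec_smul, dotProduct_smul, smul_dotProduct, smul_eq_mul, smul_eq_mul]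
    generalize αC ⬝ᵥ Ωt *ᵥ αC = q at hnn
    have hpos : 0 < 1 + q := by linarith
    have hsq := Real.mul_self_sqrt hpos.le
    rw [← mul_assoc, ← mul_inv, hsq]
    field_simp
    ring
  refine ⟨hmain, ?_⟩
  rw [← hmain, Real.sqrt_mul' _ (by linarith), div_div, mul_comm (Real.sqrt _)]
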